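/- Let h, e ∈ g satisfy [h, e] = 2e, and let Q₁, …, Q_s : g → g be ad-equivariant maps, with Q_j homogeneous of degree m_j ≥ 1 for each j. If the vectors Q₁(e), …, Q_s(e) are linearly independent, then the vectors y_j := dQ_j(e).h for j = 1, …, s are also linearly independent, and the map ad e sends the span of y₁, …, y_s bijectively onto the span of Q₁(e), …, Q_s(e). -/

import Mathlib

/-- The **Euler identity** for a homogeneous map of degree `m`. -/
theorem fderiv_apply_self_of_homogeneous {𝕜 E F : Type*} [NontriviallyNormedField 𝕜]
    [NormedAddCommGroup E] [NormedSpace 𝕜 E] [NormedAddCommGroup F] [NormedSpace 𝕜 F]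
    {Q : E → F} {m : ℕ} {x : E} (hQ : DifferentiableAt 𝕜 Q x)
    (hhom : ∀ t : 𝕜, Q (t • x) = t ^ m • Q x) :
    fderiv 𝕜 Q x x = (m : 𝕜) • Q x := by
  have hline : HasDerivAt (fun t : 𝕜 => t • x) x 1 := by
    simpa using (hasDerivAt_id (1 : 𝕜)).smul_const x
  have hchain : HasDerivAt (fun t : 𝕜 => Q (t • x)) (fderiv 𝕜 Q x x) 1 :=
    HasFDerivAt.comp_hasDerivAt (1 : 𝕜) (by simpa using hQ.hasFDerivAt) hline
  have hpow : HasDerivAt (fun t : 𝕜 => t ^ m • Q x) ((m : 𝕜) • Q x) 1 := by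
    simpa using (hasDerivAt_pow m (1 : 𝕜)).smul_const (Q x)
  simp only [hhom] at hchain
  exact hchain.unique hpow

/-- If `Q` intertwines the linear vector field `A` with the linear map `B`, then at a zero of `A`
its derivative intertwines `A` and `B`. -/
theorem fderiv_apply_of_intertwines {𝕜 E F : Type*} [NontriviallyNormedField 𝕜]
    [NormedAddCommGroup E] [NormedSpace 𝕜 E] [NormedAddCommGroup F] [NormedSpace 𝕜 F]
    {Q : E → F} {A : E →L[𝕜] E} {B : F →L[𝕜] F} (hQ : ContDiff 𝕜 2 Q)
    (hAB : ∀ x, fderiv 𝕜 Q x (A x) = B (Q x)) {x : E} (hx : A x = 0) (v : E) :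
    fderiv 𝕜 Q x (A v) = B (fderiv 𝕜 Q x v) := by
  have hdQ : DifferentiableAt 𝕜 (fderiv 𝕜 Q) x :=
    (hQ.fderiv_right (m := 1) (by norm_num)).differentiable (by norm_num) x
  have hleft := hdQ.hasFDerivAt.clm_apply (A.hasFDerivAt (x := x))
  have hright := B.hasFDerivAt.comp x (hQ.differentiable (by norm_num) x).hasFDerivAt
  have hfun : (fun x => fderiv 𝕜 Q x (A x)) = B ∘ Q := funext hAB
  rw [hfun] at hleft
  simpa [hx] using DFunLike.congr_fun (hleft.unique hright) v

/-- If a linear map sends a family `y` to nonzero multiples of a linearly independent family `q`,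
then `y` is linearly independent and the map restricts to a bijection between the spans. -/
theorem linearIndependent_and_bijOn_span_of_map_eq_smul {K V W ι : Type*} [Field K]
    [AddCommGroup V] [Module K V] [AddCommGroup W] [Module K W] (f : V →ₗ[K] W)
    {y : ι → V} {q : ι → W} {c : ι → K} (hc : ∀ i, c i ≠ 0) (hf : ∀ i, f (y i) = c i • q i)
    (hq : LinearIndependent K q) :
    LinearIndependent K y ∧
      Set.BijOn f (Submodule.span K (Set.range y) : Set V)
        (Submodule.span K (Set.range q) : Set W) := by
  have hcomp : f ∘ y = (fun i => Units.mk0 (c i) (hc i)) • q := funext hf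
  have hfy : LinearIndependent K (f ∘ y) := hcomp ▸ hq.units_smul _
  have himage : f '' (Submodule.span K (Set.range y) : Set V) =
      (Submodule.span K (Set.range q) : Set W) := by
    rw [← Submodule.map_coe, Submodule.map_span, ← Set.range_comp, hcomp]
    congr 1
    refine le_antisymm (Submodule.span_le.2 ?_) (Submodule.span_le.2 ?_)
    · rintro _ ⟨i, rfl⟩
      exact Submodule.smul_mem _ (c i) (Submodule.subset_span ⟨i, rfl⟩)
    · rintro _ ⟨i, rfl⟩
      exact (Submodule.smul_mem_iff _ (hc i)).1 (Submodule.subset_span ⟨i, rfl⟩)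
  refine ⟨hfy.of_comp f, ?_⟩
  rw [← himage]
  exact (LinearMap.disjoint_ker_iff_injOn.1 (Submodule.range_ker_disjoint hfy)).bijOn_image

theorem stmt {g : Type*} [NormedAddCommGroup g] [NormedSpace ℂ g] [FiniteDimensional ℂ g]
    -- `lie` is the Lie bracket of the finite-dimensional complex Lie algebra `g`,
    -- given as bilinear data so that it is compatible with the normed space structure.
    (lie : g →ₗ[ℂ] g →ₗ[ℂ] g)
    (lie_self : ∀ x : g, lie x x = 0)
    (lie_jacobi : ∀ x y z : g, lie x (lie y z) = lie (lie x y) z + lie y (lie x z))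
    (h e : g) (hhe : lie h e = (2 : ℂ) • e)
    (s : ℕ) (Q : Fin s → g → g) (m : Fin s → ℕ)
    (hQ : ∀ j, ContDiff ℂ ⊤ (Q j))
    (hQeq : ∀ j, ∀ x y : g, fderiv ℂ (Q j) x (lie y x) = lie y (Q j x))
    (hm : ∀ j, 1 ≤ m j)
    (hhom : ∀ j, ∀ (t : ℂ) (x : g), Q j (t • x) = t ^ (m j) • Q j x)
    (hindep : LinearIndependent ℂ (fun j => Q j e)) :
    LinearIndependent ℂ (fun j => fderiv ℂ (Q j) e h) ∧
      Set.BijOn (fun v => lie e v)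
        (Submodule.span ℂ (Set.range fun j => fderiv ℂ (Q j) e h) : Set g)
        (Submodule.span ℂ (Set.range fun j => Q j e) : Set g) := by
  refine linearIndependent_and_bijOn_span_of_map_eq_smul (lie e)
    (c := fun j => -(2 * (m j : ℂ))) (fun j => ?_) (fun j => ?_) hindep
  · have := hm j
    simp only [ne_eq, neg_eq_zero, mul_eq_zero, OfNat.ofNat_ne_zero, Nat.cast_eq_zero, false_or]
    omega
  · have hskew : lie e h = -((2 : ℂ) • e) := by
      have := lie_self (e + h)
      simp only [map_add, LinearMap.add_apply, lie_self, zero_add, add_zero] at this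
      rw [← hhe]
      exact eq_neg_of_add_eq_zero_right this
    have hQ2 : ContDiff ℂ 2 (Q j) := (hQ j).of_le le_top
    have hcomm := fderiv_apply_of_intertwines (A := (lie e).toContinuousLinearMap)
      (B := (lie e).toContinuousLinearMap) hQ2 (fun x => hQeq j x e) (lie_self e) h
    have heuler := fderiv_apply_self_of_homogeneous
      (hQ2.differentiable (by norm_num) e) (fun t => hhom j t e)
    simp only [LinearMap.coe_toContinuousLinearMap'] at hcomm
    rw [← hcomm, hskew, map_neg, map_smul, heuler, smul_smul, neg_smul]
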